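/- Let m, n ≥ 0 and p ≥ 1 be integers and let N be a real number with N > 8(m + n + p + 1). With [s]_N := sin(2πs/N)/sin(2π/N), α_t := [2t][t+1][t-1]/([2t+2][t]^2), β_t := [t-1]/([t][2]), A_i := -[6][2]/[3] + α_{m+i} + α_{n+i} + ([6][2]/[3])(β_{n+i} + β_{m+i}) - [4][2] β_{n+i} β_{m+i}, and B_k := α_{n+k} α_{m+k}, the coefficient of the theta-net recursion R_p := A_p + Σ_{i=1}^{p-1} A_i · ∏_{k=i+1}^{p} B_k is strictly negative; in particular R_p ≠ 0. -/

import Mathlib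

/-- Root-of-unity quantum integer `[s]_N = sin(2πs/N)/sin(2π/N)`, corresponding to
specializing the quantum integer at `q = e^{2πi/N}`. -/
noncomputable def qiN (N : ℝ) (s : ℤ) : ℝ :=
  Real.sin (2 * Real.pi * s / N) / Real.sin (2 * Real.pi / N)

/-- The coefficient `α_t = [2t][t+1][t-1]/([2t+2][t]^2)`. -/
noncomputable def alphaN (N : ℝ) (t : ℤ) : ℝ :=
  qiN N (2 * t) * qiN N (t + 1) * qiN N (t - 1) / (qiN N (2 * t + 2) * (qiN N t) ^ 2)

/-- The coefficient `β_t = [t-1]/([t][2])`. -/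
noncomputable def betaN (N : ℝ) (t : ℤ) : ℝ :=
  qiN N (t - 1) / (qiN N t * qiN N 2)

/-- The coefficient
`A_i = -[6][2]/[3] + α_{m+i} + α_{n+i} + ([6][2]/[3])(β_{n+i}+β_{m+i}) - [4][2]β_{n+i}β_{m+i}`. -/
noncomputable def coeffA (N : ℝ) (m n : ℕ) (i : ℕ) : ℝ :=
  -(qiN N 6 * qiN N 2) / qiN N 3 + alphaN N ((m : ℤ) + i) + alphaN N ((n : ℤ) + i)
    + (qiN N 6 * qiN N 2 / qiN N 3) * (betaN N ((n : ℤ) + i) + betaN N ((m : ℤ) + i))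
    - qiN N 4 * qiN N 2 * (betaN N ((n : ℤ) + i) * betaN N ((m : ℤ) + i))

/-- The coefficient `B_k = α_{n+k} α_{m+k}`. -/
noncomputable def coeffB (N : ℝ) (m n : ℕ) (k : ℕ) : ℝ :=
  alphaN N ((n : ℤ) + k) * alphaN N ((m : ℤ) + k)

theorem qiN_eq (N : ℝ) (s : ℤ) :
    qiN N s = Real.sin (s * (2 * Real.pi / N)) / Real.sin (2 * Real.pi / N) := by
  unfold qiN
  congr 2
  ring

section

variable {N θ : ℝ} {t : ℤ}

theorem sin_pos_of_eight_mul_lt (h0 : 0 < θ) (h1 : 8 * θ < Real.pi) : 0 < Real.sin θ :=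
  Real.sin_pos_of_pos_of_lt_pi h0 (by linarith)

theorem cos_pos_of_eight_mul_lt (h0 : 0 < θ) (h1 : 8 * θ < Real.pi) : 0 < Real.cos θ :=
  Real.cos_pos_of_mem_Ioo ⟨by linarith, by linarith⟩

/-- Closed form of `α_t` in terms of the angle `θ = 2π/N`. -/
theorem alphaN_eq (hθ : θ = 2 * Real.pi / N) (h0 : 0 < θ) (ht : 1 ≤ t)
    (h : 4 * ((t + 1) * θ) < Real.pi) :
    alphaN N t = Real.cos (t * θ) * Real.sin (t * θ - θ) /
      (Real.cos (t * θ + θ) * Real.sin (t * θ)) := by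
  have htR : (1 : ℝ) ≤ t := by exact_mod_cast ht
  have htθ : θ ≤ t * θ := by nlinarith
  have hS : 0 < Real.sin θ := sin_pos_of_eight_mul_lt h0 (by linarith)
  have ha : 0 < Real.sin (t * θ) := Real.sin_pos_of_pos_of_lt_pi (by linarith) (by linarith)
  have ha' : 0 < Real.sin (t * θ + θ) := Real.sin_pos_of_pos_of_lt_pi (by linarith) (by linarith)
  have hb' : 0 < Real.cos (t * θ + θ) := Real.cos_pos_of_mem_Ioo ⟨by linarith, by linarith⟩
  unfold alphaN
  simp only [qiN_eq, ← hθ]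
  push_cast
  rw [show (2 * (t : ℝ)) * θ = 2 * (t * θ) by ring,
    show (2 * (t : ℝ) + 2) * θ = 2 * (t * θ + θ) by ring,
    show ((t : ℝ) + 1) * θ = t * θ + θ by ring,
    show ((t : ℝ) - 1) * θ = t * θ - θ by ring, Real.sin_two_mul, Real.sin_two_mul]
  generalize Real.sin (t * θ + θ) = u at *
  generalize Real.cos (t * θ + θ) = v at *
  generalize Real.sin (t * θ - θ) = w at *
  field_simp

theorem alphaN_nonneg (hθ : θ = 2 * Real.pi / N) (h0 : 0 < θ) (ht : 1 ≤ t)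
    (h : 4 * ((t + 1) * θ) < Real.pi) : 0 ≤ alphaN N t := by
  have htR : (1 : ℝ) ≤ t := by exact_mod_cast ht
  have htθ : θ ≤ t * θ := by nlinarith
  rw [alphaN_eq hθ h0 ht h]
  have ha : 0 ≤ Real.sin (t * θ) := Real.sin_nonneg_of_nonneg_of_le_pi (by linarith) (by linarith)
  have ha' : 0 ≤ Real.sin (t * θ - θ) :=
    Real.sin_nonneg_of_nonneg_of_le_pi (by linarith) (by linarith)
  have hb : 0 ≤ Real.cos (t * θ) := Real.cos_nonneg_of_mem_Icc ⟨by linarith, by linarith⟩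
  have hb' : 0 ≤ Real.cos (t * θ + θ) := Real.cos_nonneg_of_mem_Icc ⟨by linarith, by linarith⟩
  positivity

theorem alphaN_le (hθ : θ = 2 * Real.pi / N) (h0 : 0 < θ) (ht : 1 ≤ t)
    (h : 4 * ((t + 1) * θ) < Real.pi) : alphaN N t ≤ 1 - 4 * Real.sin θ ^ 2 := by
  have htR : (1 : ℝ) ≤ t := by exact_mod_cast ht
  have htθ : θ ≤ t * θ := by nlinarith
  rw [alphaN_eq hθ h0 ht h]
  have hS : 0 < Real.sin θ := sin_pos_of_eight_mul_lt h0 (by linarith)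
  have ha : 0 < Real.sin (t * θ) := Real.sin_pos_of_pos_of_lt_pi (by linarith) (by linarith)
  have hb' : 0 < Real.cos (t * θ + θ) := Real.cos_pos_of_mem_Ioo ⟨by linarith, by linarith⟩
  have h1 : Real.sin (2 * θ) ≤ Real.cos (2 * (t * θ)) := by
    rw [← Real.cos_pi_div_two_sub]
    exact Real.cos_le_cos_of_nonneg_of_le_pi (by linarith) (by linarith) (by linarith)
  have h2 : Real.sin (2 * (t * θ) + θ) ≤ Real.cos θ := by
    rw [← Real.sin_pi_div_two_sub]
    exact Real.sin_le_sin_of_le_of_le_pi_div_two (by linarith) (by linarith) (by linarith)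
  rw [div_le_iff₀ (by positivity)]
  rw [Real.sin_add, Real.sin_two_mul, Real.cos_two_mul'] at h2
  rw [Real.sin_two_mul, Real.cos_two_mul'] at h1
  rw [Real.sin_sub, Real.cos_add]
  have h3 := mul_le_mul_of_nonneg_left h1 hS.le
  have h4 := mul_le_mul_of_nonneg_left h2 (sq_nonneg (Real.sin θ))
  have h5 := Real.sin_sq_add_cos_sq ((t : ℝ) * θ)
  generalize Real.sin ((t : ℝ) * θ) = a at *
  generalize Real.cos ((t : ℝ) * θ) = b at *
  have h6 : Real.sin θ ^ 3 * (a ^ 2 + b ^ 2) = Real.sin θ ^ 3 := by rw [h5, mul_one]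
  have h7 := pow_pos hS 3
  linarith

theorem betaN_eq (hθ : θ = 2 * Real.pi / N) (h0 : 0 < θ) (ht : 1 ≤ t)
    (h : 4 * ((t + 1) * θ) < Real.pi) :
    betaN N t = (Real.cos θ - Real.sin θ * (Real.cos (t * θ) / Real.sin (t * θ))) /
      (2 * Real.cos θ) := by
  have htR : (1 : ℝ) ≤ t := by exact_mod_cast ht
  have htθ : θ ≤ t * θ := by nlinarith
  have hS : 0 < Real.sin θ := sin_pos_of_eight_mul_lt h0 (by linarith)
  have hc : 0 < Real.cos θ := cos_pos_of_eight_mul_lt h0 (by linarith)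
  have ha : 0 < Real.sin (t * θ) := Real.sin_pos_of_pos_of_lt_pi (by linarith) (by linarith)
  unfold betaN
  simp only [qiN_eq, ← hθ]
  push_cast
  rw [show ((t : ℝ) - 1) * θ = t * θ - θ by ring, Real.sin_sub, Real.sin_two_mul]
  field_simp

theorem one_le_cos_div_sin (h0 : 0 < θ) (ht : 1 ≤ t) (h : 4 * ((t + 1) * θ) < Real.pi) :
    1 ≤ Real.cos (t * θ) / Real.sin (t * θ) := by
  have htR : (1 : ℝ) ≤ t := by exact_mod_cast ht
  have htθ : θ ≤ t * θ := by nlinarith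
  have ha : 0 < Real.sin (t * θ) := Real.sin_pos_of_pos_of_lt_pi (by linarith) (by linarith)
  rw [one_le_div ha, ← Real.sin_pi_div_two_sub]
  exact Real.sin_le_sin_of_le_of_le_pi_div_two (by linarith) (by linarith) (by linarith)

end

theorem coeffA_neg {N θ : ℝ} {m n i : ℕ} (hθ : θ = 2 * Real.pi / N) (h0 : 0 < θ) (hi : 1 ≤ i)
    (hm : 4 * (((m : ℝ) + i + 1) * θ) < Real.pi) (hn : 4 * (((n : ℝ) + i + 1) * θ) < Real.pi) :
    coeffA N m n i < 0 := by
  have hmi : (1 : ℤ) ≤ (m : ℤ) + i := by omega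
  have hni : (1 : ℤ) ≤ (n : ℤ) + i := by omega
  have hm' : 4 * ((((m : ℤ) + i : ℤ) + 1 : ℝ) * θ) < Real.pi := by push_cast; exact hm
  have hn' : 4 * ((((n : ℤ) + i : ℤ) + 1 : ℝ) * θ) < Real.pi := by push_cast; exact hn
  have h8 : 8 * θ < Real.pi := by
    have : (1 : ℝ) ≤ i := by exact_mod_cast hi
    have : (0 : ℝ) ≤ m := m.cast_nonneg
    nlinarith
  have hS := sin_pos_of_eight_mul_lt h0 h8
  have hc := cos_pos_of_eight_mul_lt h0 h8
  have h3 : 0 < Real.sin (3 * θ) := Real.sin_pos_of_pos_of_lt_pi (by linarith) (by linarith)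
  have hsc : Real.sin (2 * θ) ≤ Real.cos (2 * θ) := by
    rw [← Real.sin_pi_div_two_sub]
    exact Real.sin_le_sin_of_le_of_le_pi_div_two (by linarith) (by linarith) (by linarith)
  have hsc1 : Real.cos (2 * θ) ≤ 1 := Real.cos_le_one _
  have hα := alphaN_le hθ h0 hmi hm'
  have hα' := alphaN_le hθ h0 hni hn'
  have hx := one_le_cos_div_sin h0 hmi hm'
  have hy := one_le_cos_div_sin h0 hni hn'
  have hK : qiN N 6 * qiN N 2 / qiN N 3 = 4 * Real.cos (3 * θ) * Real.cos θ := by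
    simp only [qiN_eq, ← hθ]
    push_cast
    rw [show (6 : ℝ) * θ = 2 * (3 * θ) by ring, Real.sin_two_mul, Real.sin_two_mul]
    field_simp
    ring
  have hL : qiN N 4 * qiN N 2 = 8 * Real.cos θ ^ 2 * Real.cos (2 * θ) := by
    simp only [qiN_eq, ← hθ]
    push_cast
    rw [show (4 : ℝ) * θ = 2 * (2 * θ) by ring, Real.sin_two_mul (2 * θ), Real.sin_two_mul]
    field_simp
    ring
  unfold coeffA
  rw [neg_div, hK, hL, betaN_eq hθ h0 hmi hm', betaN_eq hθ h0 hni hn']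
  generalize Real.cos (((m : ℤ) + i : ℤ) * θ) / Real.sin (((m : ℤ) + i : ℤ) * θ) = x at *
  generalize Real.cos (((n : ℤ) + i : ℤ) * θ) / Real.sin (((n : ℤ) + i : ℤ) * θ) = y at *
  generalize alphaN N ((m : ℤ) + i) = α at *
  generalize alphaN N ((n : ℤ) + i) = α' at *
  have hpy := Real.sin_sq_add_cos_sq θ
  have hexp : -(4 * Real.cos (3 * θ) * Real.cos θ) + α + α'
      + 4 * Real.cos (3 * θ) * Real.cos θ *
        ((Real.cos θ - Real.sin θ * y) / (2 * Real.cos θ)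
          + (Real.cos θ - Real.sin θ * x) / (2 * Real.cos θ))
      - 8 * Real.cos θ ^ 2 * Real.cos (2 * θ) *
        ((Real.cos θ - Real.sin θ * y) / (2 * Real.cos θ)
          * ((Real.cos θ - Real.sin θ * x) / (2 * Real.cos θ)))
      = α + α' + 2 * Real.sin θ ^ 2 * Real.sin (2 * θ) * (x + y)
        - 2 * Real.cos (2 * θ) * (Real.cos θ ^ 2 + Real.sin θ ^ 2 * (x * y)) := by
    rw [show 3 * θ = 2 * θ + θ by ring, Real.cos_add]
    field_simp
    ring
  rw [hexp]
  have hs2 : 0 < Real.sin (2 * θ) := Real.sin_pos_of_pos_of_lt_pi (by linarith) (by linarith)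
  have hs2' : Real.sin (2 * θ) < 1 := by
    rw [← Real.sin_pi_div_two]
    exact Real.sin_lt_sin_of_lt_of_le_pi_div_two (by linarith) (by linarith) (by linarith)
  have hC : Real.cos (2 * θ) = 1 - 2 * Real.sin θ ^ 2 := by
    rw [Real.cos_two_mul]; linarith
  have hxy : Real.sin (2 * θ) * (x + y) - Real.cos (2 * θ) * (x * y)
      ≤ 2 * Real.sin (2 * θ) - Real.cos (2 * θ) := by
    have e1 : 0 ≤ (x - 1) * (y - 1) := mul_nonneg (by linarith) (by linarith)
    have e2 : 0 ≤ (Real.cos (2 * θ) - Real.sin (2 * θ)) * ((x - 1) + (y - 1)) :=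
      mul_nonneg (by linarith) (by linarith)
    have e3 := mul_nonneg (hs2.le.trans hsc) e1
    linarith
  have hS2 : 0 < Real.sin θ ^ 2 := by positivity
  have e4 := mul_le_mul_of_nonneg_left hxy hS2.le
  have e5 := mul_lt_mul_of_pos_left hs2' hS2
  have e6 : Real.cos (2 * θ) * (Real.sin θ ^ 2 + Real.cos θ ^ 2) = 1 - 2 * Real.sin θ ^ 2 := by
    rw [hpy, mul_one, hC]
  linarith

theorem coeffB_nonneg {N θ : ℝ} {m n k : ℕ} (hθ : θ = 2 * Real.pi / N) (h0 : 0 < θ) (hk : 1 ≤ k)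
    (hm : 4 * (((m : ℝ) + k + 1) * θ) < Real.pi) (hn : 4 * (((n : ℝ) + k + 1) * θ) < Real.pi) :
    0 ≤ coeffB N m n k :=
  mul_nonneg (alphaN_nonneg hθ h0 (by omega) (by push_cast; exact hn))
    (alphaN_nonneg hθ h0 (by omega) (by push_cast; exact hm))

/-- The coefficient `R_p = A_p + Σ_{i=1}^{p-1} A_i ∏_{k=i+1}^p B_k` of the theta-net
recursion is strictly negative for `N > 8(m+n+p+1)`; in particular it is nonzero. -/
theorem thetaNetCoeff_neg (m n p : ℕ) (hp : 1 ≤ p) (N : ℝ)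
    (hN : 8 * ((m : ℝ) + n + p + 1) < N) :
    (coeffA N m n p + ∑ i ∈ Finset.Icc 1 (p - 1),
        coeffA N m n i * ∏ k ∈ Finset.Icc (i + 1) p, coeffB N m n k) < 0 ∧
      (coeffA N m n p + ∑ i ∈ Finset.Icc 1 (p - 1),
        coeffA N m n i * ∏ k ∈ Finset.Icc (i + 1) p, coeffB N m n k) ≠ 0 := by
  have hN0 : 0 < N := lt_of_le_of_lt (by positivity) hN
  obtain ⟨θ, hθ⟩ : ∃ θ, θ = 2 * Real.pi / N := ⟨_, rfl⟩
  have h0 : 0 < θ := by rw [hθ]; positivity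
  have hbound : ∀ x : ℝ, x ≤ (m : ℝ) + n + p + 1 → 4 * (x * θ) < Real.pi := by
    intro x hx
    have hxN : 8 * x < N := by linarith
    have hNθ : N * θ = 2 * Real.pi := by rw [hθ]; field_simp
    nlinarith [mul_lt_mul_of_pos_right hxN h0]
  have hm : ∀ i ≤ p, 4 * (((m : ℝ) + i + 1) * θ) < Real.pi := fun i hi =>
    hbound _ (by
      have : (i : ℝ) ≤ p := by exact_mod_cast hi
      linarith [n.cast_nonneg (α := ℝ)])
  have hn : ∀ i ≤ p, 4 * (((n : ℝ) + i + 1) * θ) < Real.pi := fun i hi =>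
    hbound _ (by
      have : (i : ℝ) ≤ p := by exact_mod_cast hi
      linarith [m.cast_nonneg (α := ℝ)])
  have hsum : ∑ i ∈ Finset.Icc 1 (p - 1),
      coeffA N m n i * ∏ k ∈ Finset.Icc (i + 1) p, coeffB N m n k ≤ 0 := by
    refine Finset.sum_nonpos fun i hi => ?_
    rw [Finset.mem_Icc] at hi
    refine mul_nonpos_of_nonpos_of_nonneg
      (coeffA_neg hθ h0 hi.1 (hm i (by omega)) (hn i (by omega))).le
      (Finset.prod_nonneg fun k hk => ?_)
    rw [Finset.mem_Icc] at hk
    exact coeffB_nonneg hθ h0 (by omega) (hm k hk.2) (hn k hk.2)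
  have hneg := add_neg_of_neg_of_nonpos (coeffA_neg hθ h0 hp (hm p le_rfl) (hn p le_rfl)) hsum
  exact ⟨hneg, hneg.ne⟩
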